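/- Let C be the F_qF_{q²}-additive code of block length (α, β) given by the F_q-row span of a k × (α + β) matrix G = (G_α | G_β), where G_α is a k × α matrix over F_q and G_β is a k × β matrix over F_{q²}. Suppose (i) the F_q-linear code C_α ⊆ F_q^α spanned by the rows of G_α is self-orthogonal with respect to the standard inner product on F_q^α, (ii) the rows of G_β are linearly independent over F_q in F_{q²}^β, and (iii) the Gray image φ(C_β) ⊆ F_q^{2β} of the projection C_β is an LCD code over F_q. Then Φ(C) ⊆ F_q^{α+2β} is an LCD code over F_q. -/

import Mathlib

noncomputable section

variable (Fq Fq2 : Type*) [Field Fq] [Field Fq2] [Algebra Fq Fq2]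

/-- The standard (Euclidean) inner product on `F_q^β × F_q^β ≅ F_q^{2β}`. -/
def inner2 (β : ℕ) (x y : (Fin β → Fq) × (Fin β → Fq)) : Fq :=
  ∑ j, x.1 j * y.1 j + ∑ j, x.2 j * y.2 j

/-- The standard (Euclidean) inner product on `F_q^α × F_q^β × F_q^β ≅ F_q^{α+2β}`. -/
def inner3 (α β : ℕ) (x y : (Fin α → Fq) × (Fin β → Fq) × (Fin β → Fq)) : Fq :=
  ∑ i, x.1 i * y.1 i + ∑ j, x.2.1 j * y.2.1 j + ∑ j, x.2.2 j * y.2.2 j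

/-- **Theorem.** Let `C ⊆ F_q^α × F_{q²}^β` be the `F_q`-row span of a `k × (α + β)` matrix
`G = (G_α ∣ G_β)` with `G_α` over `F_q` and `G_β` over `F_{q²}`; `{1, ω}` an `F_q`-basis of
`F_{q²}` with coordinate functions `bc, cc` (so `z = bc z + ω·cc z`); `φ` the Gray map
`F_{q²}^β → F_q^{2β}` and `Φ(u ∣ u') = (u, φ(u'))`. Suppose (i) the `F_q`-linear code
`C_α`, spanned by the rows of `G_α`, is self-orthogonal, (ii) the rows of `G_β` are
`F_q`-linearly independent, and (iii) `φ(C_β)` is an LCD code over `F_q`, where `C_β` is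
spanned by the rows of `G_β`. Then `Φ(C) ⊆ F_q^{α+2β}` is an LCD code over `F_q`. -/
theorem stmt_14 (α β k : ℕ) (ω : Fq2) (bc cc : Fq2 → Fq)
    (hdec : ∀ z : Fq2, z = algebraMap Fq Fq2 (bc z) + algebraMap Fq Fq2 (cc z) * ω)
    (hind : ∀ x y : Fq, algebraMap Fq Fq2 x + algebraMap Fq Fq2 y * ω = 0 →
      x = 0 ∧ y = 0)
    (φ : (Fin β → Fq2) → (Fin β → Fq) × (Fin β → Fq))
    (hφ : ∀ u', φ u' = (fun i => bc (u' i) + cc (u' i), fun i => cc (u' i)))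
    (Φ : (Fin α → Fq) × (Fin β → Fq2) →
      (Fin α → Fq) × (Fin β → Fq) × (Fin β → Fq))
    (hΦ : ∀ p, Φ p = (p.1, φ p.2))
    (Gα : Matrix (Fin k) (Fin α) Fq) (Gβ : Matrix (Fin k) (Fin β) Fq2)
    (C : Submodule Fq ((Fin α → Fq) × (Fin β → Fq2)))
    (hC : C = Submodule.span Fq (Set.range fun j : Fin k => (Gα j, Gβ j)))
    (Cα : Submodule Fq (Fin α → Fq))
    (hCα : Cα = Submodule.span Fq (Set.range fun j : Fin k => Gα j))
    (Cβ : Submodule Fq (Fin β → Fq2))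
    (hCβ : Cβ = Submodule.span Fq (Set.range fun j : Fin k => Gβ j))
    -- (i) `C_α` is self-orthogonal
    (hso : ∀ x ∈ Cα, ∀ y ∈ Cα, ∑ i, x i * y i = 0)
    -- (ii) the rows of `G_β` are linearly independent over `F_q`
    (hli : LinearIndependent Fq fun j : Fin k => (Gβ j : Fin β → Fq2))
    -- (iii) `φ(C_β)` is LCD over `F_q`
    (hlcd : ∀ v ∈ φ '' (Cβ : Set _),
      (∀ w ∈ φ '' (Cβ : Set _), inner2 Fq β v w = 0) → v = 0) :
    ∀ v ∈ Φ '' (C : Set _),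
      (∀ w ∈ Φ '' (C : Set _), inner3 Fq α β v w = 0) → v = 0 := by
  rintro _ ⟨c, hc, rfl⟩ horth
  have mem_snd : ∀ d ∈ C, d.2 ∈ Cβ := by
    intro d hd
    rw [hC, Submodule.mem_span_range_iff_exists_fun] at hd
    rw [hCβ, Submodule.mem_span_range_iff_exists_fun]
    obtain ⟨l, rfl⟩ := hd
    exact ⟨l, by simp [Prod.snd_sum]⟩
  have mem_fst : ∀ d ∈ C, d.1 ∈ Cα := by
    intro d hd
    rw [hC, Submodule.mem_span_range_iff_exists_fun] at hd
    rw [hCα, Submodule.mem_span_range_iff_exists_fun]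
    obtain ⟨l, rfl⟩ := hd
    exact ⟨l, by simp [Prod.fst_sum]⟩
  have lift_snd : ∀ b ∈ Cβ, ∃ a, (a, b) ∈ C := by
    intro b hb
    rw [hCβ, Submodule.mem_span_range_iff_exists_fun] at hb
    obtain ⟨l, rfl⟩ := hb
    refine ⟨∑ j, l j • Gα j, ?_⟩
    rw [hC, Submodule.mem_span_range_iff_exists_fun]
    exact ⟨l, by ext <;> simp [Prod.fst_sum, Prod.snd_sum]⟩
  have hgray : φ c.2 = 0 := by
    refine hlcd _ ⟨c.2, mem_snd c hc, rfl⟩ ?_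
    rintro _ ⟨b, hb, rfl⟩
    obtain ⟨a, hab⟩ := lift_snd b hb
    have h := horth _ ⟨(a, b), hab, rfl⟩
    simpa [inner3, inner2, hΦ, hso _ (mem_fst c hc) a (mem_fst _ hab)] using h
  have hsnd : c.2 = 0 := by
    have h := hgray
    rw [hφ, Prod.mk_eq_zero] at h
    funext i
    have hcc : cc (c.2 i) = 0 := congrFun h.2 i
    have hbc : bc (c.2 i) = 0 := by simpa [hcc] using congrFun h.1 i
    rw [hdec (c.2 i), hbc, hcc]
    simp
  have hfst : c.1 = 0 := by
    rw [hC, SetLike.mem_coe, Submodule.mem_span_range_iff_exists_fun] at hc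
    obtain ⟨l, rfl⟩ := hc
    have hl : ∀ j, l j = 0 :=
      Fintype.linearIndependent_iff.mp hli l (by simpa [Prod.snd_sum] using hsnd)
    simp [hl]
  rw [hΦ, hfst, hgray]
  rfl

end
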